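/- Let α ≥ 1. Any reprincipal α-periodic repeat in a word w is birepresented; that is, if σ is the principal repeat of a maximal repetition and σ is α-periodic, then σ is a periodic repeat represented by a pair of two distinct maximal repetitions (it cannot be represented by a single maximal repetition). -/

import Mathlib

variable {A : Type*}

/-- `p` is a period of the factor `w[i..j]` of the word `w` (positions are 1-based):
`1 ≤ p ≤ j - i + 1` and `w[k] = w[k+p]` whenever both positions lie in `[i, j]`. -/
def IsPeriodOf (w : ℕ → A) (i j p : ℕ) : Prop :=
  1 ≤ p ∧ p ≤ j - i + 1 ∧ ∀ k, i ≤ k → k + p ≤ j → w k = w (k + p)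

/-- The minimal period of the factor `w[i..j]`. -/
noncomputable def minPer (w : ℕ → A) (i j : ℕ) : ℕ :=
  sInf {p | IsPeriodOf w i j p}

/-- The maximality conditions for a factor `w[i..j]` of the word `w` of length `n`,
with respect to its minimal period: it cannot be extended to the left or to the right
by one letter preserving the minimal period. -/
def MaxCond (n : ℕ) (w : ℕ → A) (i j : ℕ) : Prop :=
  (1 < i → w (i - 1) ≠ w (i + minPer w i j - 1)) ∧
  (j < n → w (j + 1) ≠ w (j - minPer w i j + 1))

/-- `w[i..j]` is a maximal repetition (run) in the word `w` of length `n`. -/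
def IsMaxRepetition (n : ℕ) (w : ℕ → A) (i j : ℕ) : Prop :=
  1 ≤ i ∧ i ≤ j ∧ j ≤ n ∧ 2 * minPer w i j ≤ j - i + 1 ∧ MaxCond n w i j

/-- `w[i..j]` is a maximal subrepetition in the word `w` of length `n`:
its exponent is strictly between 1 and 2 and it satisfies the maximality conditions. -/
def IsMaxSubrepetition (n : ℕ) (w : ℕ → A) (i j : ℕ) : Prop :=
  1 ≤ i ∧ i ≤ j ∧ j ≤ n ∧ minPer w i j < j - i + 1 ∧
    j - i + 1 < 2 * minPer w i j ∧ MaxCond n w i j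

/-- A repeat in the word `w` of length `n`: a pair of equal factors
`w[b1..e1]` (left copy) and `w[b2..e2]` (right copy) with `b1 < b2`. -/
structure WordRepeat (n : ℕ) (w : ℕ → A) where
  b1 : ℕ
  e1 : ℕ
  b2 : ℕ
  e2 : ℕ
  one_le_b1 : 1 ≤ b1
  b1_le_e1 : b1 ≤ e1
  b2_le_e2 : b2 ≤ e2
  e2_le_n : e2 ≤ n
  b1_lt_b2 : b1 < b2
  len_eq : e1 - b1 = e2 - b2
  copies_eq : ∀ k, k ≤ e1 - b1 → w (b1 + k) = w (b2 + k)

namespace WordRepeat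

variable {n : ℕ} {w : ℕ → A}

/-- The period of the repeat. -/
def p (σ : WordRepeat n w) : ℕ := σ.b2 - σ.b1

/-- The length of the copies of the repeat. -/
def c (σ : WordRepeat n w) : ℕ := σ.e1 - σ.b1 + 1

/-- The repeat is maximal: its copies cannot be simultaneously extended to the left
or to the right preserving the period. (`fact σ = w[b1..e2]`.) -/
def Maximal (σ : WordRepeat n w) : Prop :=
  (1 < σ.b1 → w (σ.b1 - 1) ≠ w (σ.b2 - 1)) ∧
  (σ.e2 < n → w (σ.e1 + 1) ≠ w (σ.e2 + 1))

/-- The repeat is overlapped: its copies are overlapped factors. -/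
def Overlapped (σ : WordRepeat n w) : Prop := σ.b2 ≤ σ.e1 + 1

/-- The repeat is gapped: there is a nonempty gap between its copies. -/
def Gapped (σ : WordRepeat n w) : Prop := σ.e1 + 1 < σ.b2

/-- The repeat is `α`-gapped: it is gapped and `p(σ) ≤ α ⬝ c(σ)`. -/
def AlphaGapped (α : ℝ) (σ : WordRepeat n w) : Prop :=
  σ.Gapped ∧ (σ.p : ℝ) ≤ α * (σ.c : ℝ)

/-- `σ` is covered by `σ'`: `fact σ = w[σ.b1..σ.e2]` is contained in
`fact σ' = w[σ'.b1..σ'.e2]` and `p(σ') < p(σ)`. -/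
def CoveredBy (σ σ' : WordRepeat n w) : Prop :=
  σ'.b1 ≤ σ.b1 ∧ σ.e2 ≤ σ'.e2 ∧ σ'.p < σ.p

end WordRepeat

/-- `σ` is the principal repeat of some maximal repetition of `w`
(a reprincipal repeat). -/
def IsPrincipalOfMaxRepetition {n : ℕ} {w : ℕ → A} (σ : WordRepeat n w) : Prop :=
  ∃ i j, IsMaxRepetition n w i j ∧ σ.b1 = i ∧ σ.e1 = j - minPer w i j ∧
    σ.b2 = i + minPer w i j ∧ σ.e2 = j

/-- `σ` is principal: it is the principal repeat of some maximal repetition or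
maximal subrepetition of `w`. -/
def IsPrincipal {n : ℕ} {w : ℕ → A} (σ : WordRepeat n w) : Prop :=
  ∃ i j, (IsMaxRepetition n w i j ∨ IsMaxSubrepetition n w i j) ∧ σ.b1 = i ∧
    σ.e1 = j - minPer w i j ∧ σ.b2 = i + minPer w i j ∧ σ.e2 = j

/-- `σ` is a periodic repeat: its copies are repetitions whose minimal period
is at most `c(σ)/3`. -/
def IsPeriodicRepeat {n : ℕ} {w : ℕ → A} (σ : WordRepeat n w) : Prop :=
  3 * minPer w σ.b1 σ.e1 ≤ σ.c

/-- The periodic repeat `σ` is represented by the maximal repetition `w[i..j]`: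
both copies of `σ` extend (preserving their minimal period) to `w[i..j]`;
equivalently, `w[i..j]` is a maximal repetition whose minimal period equals the
minimal period of the copies of `σ` and which contains both copies of `σ`. -/
def RepresentedBy {n : ℕ} {w : ℕ → A} (σ : WordRepeat n w) (i j : ℕ) : Prop :=
  IsPeriodicRepeat σ ∧ IsMaxRepetition n w i j ∧
  minPer w i j = minPer w σ.b1 σ.e1 ∧ i ≤ σ.b1 ∧ σ.e2 ≤ j

/-- The periodic repeat `σ` is represented by the pair of distinct maximal repetitions
`w[i1..j1]`, `w[i2..j2]`: the left copy of `σ` extends to `w[i1..j1]`, the right copy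
extends to `w[i2..j2]`, the two repetitions being distinct (`σ` is birepresented). -/
def RepresentedByPair {n : ℕ} {w : ℕ → A} (σ : WordRepeat n w)
    (i1 j1 i2 j2 : ℕ) : Prop :=
  IsPeriodicRepeat σ ∧ IsMaxRepetition n w i1 j1 ∧ IsMaxRepetition n w i2 j2 ∧
  minPer w i1 j1 = minPer w σ.b1 σ.e1 ∧ minPer w i2 j2 = minPer w σ.b1 σ.e1 ∧
  i1 ≤ σ.b1 ∧ σ.e1 ≤ j1 ∧ i2 ≤ σ.b2 ∧ σ.e2 ≤ j2 ∧ ¬(i1 = i2 ∧ j1 = j2)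


theorem isPeriodOf_length (w : ℕ → A) (i j : ℕ) :
    IsPeriodOf w i j (j - i + 1) :=
  ⟨by omega, le_rfl, fun k hk hkj => by omega⟩

theorem isPeriodOf_minPer (w : ℕ → A) (i j : ℕ) :
    IsPeriodOf w i j (minPer w i j) :=
  Nat.sInf_mem (s := {p | IsPeriodOf w i j p}) ⟨_, isPeriodOf_length w i j⟩

theorem minPer_le {w : ℕ → A} {i j p : ℕ} (h : IsPeriodOf w i j p) :
    minPer w i j ≤ p :=
  Nat.sInf_le (s := {p | IsPeriodOf w i j p}) h

/-- A period of a factor is a period of each of its subfactors that is long enough. -/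
theorem IsPeriodOf.subfactor {w : ℕ → A} {i j i' j' p : ℕ}
    (h : IsPeriodOf w i' j' p) (hi : i' ≤ i) (hj : j ≤ j') (hp : p ≤ j - i + 1) :
    IsPeriodOf w i j p :=
  ⟨h.1, hp, fun k hk hkj => h.2.2 k (hi.trans hk) (hkj.trans hj)⟩

/-- If the minimal period of a factor is a period of a larger factor, it is its minimal period. -/
theorem minPer_eq_of_isPeriodOf_minPer {w : ℕ → A} {i j i' j' : ℕ} (hi : i' ≤ i)
    (hj : j ≤ j') (h : IsPeriodOf w i' j' (minPer w i j)) :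
    minPer w i' j' = minPer w i j := by
  have hle := minPer_le h
  have hsub := (isPeriodOf_minPer w i' j').subfactor hi hj
    (hle.trans (isPeriodOf_minPer w i j).2.1)
  exact le_antisymm hle (minPer_le hsub)

/-- Every repetition extends to a maximal repetition with the same minimal period. -/
theorem exists_isMaxRepetition_extending {n : ℕ} {w : ℕ → A} {i j : ℕ}
    (hi : 1 ≤ i) (hij : i ≤ j) (hj : j ≤ n) (hrep : 2 * minPer w i j ≤ j - i + 1) :
    ∃ i' j', IsMaxRepetition n w i' j' ∧ minPer w i' j' = minPer w i j ∧ i' ≤ i ∧ j ≤ j' := by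
  induction hm : i + (n - j) using Nat.strong_induction_on generalizing i j with
  | _ m ih =>
    obtain ⟨hq1, hq2, hq⟩ := isPeriodOf_minPer w i j
    by_cases hL : 1 < i ∧ w (i - 1) = w (i + minPer w i j - 1)
    · have hper : IsPeriodOf w (i - 1) j (minPer w i j) := by
        refine ⟨hq1, by omega, fun k hk hkj => ?_⟩
        rcases Nat.lt_or_ge k i with hki | hki
        · obtain rfl : k = i - 1 := by omega
          rw [hL.2]
          congr 1
          omega
        · exact hq k hki hkj
      have heq := minPer_eq_of_isPeriodOf_minPer (Nat.sub_le i 1) le_rfl hper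
      obtain ⟨i', j', hmax, hmin, hi', hj'⟩ := ih (i - 1 + (n - j)) (by omega) (by omega)
        (by omega) hj (by omega) rfl
      exact ⟨i', j', hmax, hmin.trans heq, by omega, hj'⟩
    by_cases hR : j < n ∧ w (j + 1) = w (j - minPer w i j + 1)
    · have hper : IsPeriodOf w i (j + 1) (minPer w i j) := by
        refine ⟨hq1, by omega, fun k hk hkj => ?_⟩
        rcases Nat.lt_or_ge j (k + minPer w i j) with hkj' | hkj'
        · have hk1 : k + minPer w i j = j + 1 := by omega
          rw [hk1, hR.2]
          congr 1
          omega
        · exact hq k hk hkj'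
      have heq := minPer_eq_of_isPeriodOf_minPer le_rfl (Nat.le_succ j) hper
      obtain ⟨i', j', hmax, hmin, hi', hj'⟩ := ih (i + (n - (j + 1))) (by omega) hi
        (by omega) hR.1 (by omega) rfl
      exact ⟨i', j', hmax, hmin.trans heq, hi', by omega⟩
    exact ⟨i, j, ⟨hi, hij, hj, hrep, fun h h' => hL ⟨h, h'⟩, fun h h' => hR ⟨h, h'⟩⟩,
      rfl, le_rfl, le_rfl⟩

/-- The two copies of a repeat have the same periods. -/
theorem WordRepeat.isPeriodOf_iff {n : ℕ} {w : ℕ → A} (σ : WordRepeat n w) (p : ℕ) :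
    IsPeriodOf w σ.b1 σ.e1 p ↔ IsPeriodOf w σ.b2 σ.e2 p := by
  have h1 := σ.b1_le_e1
  have h2 := σ.b2_le_e2
  have hlen := σ.len_eq
  have hshift : ∀ k, k ≤ σ.e1 - σ.b1 → w (σ.b1 + k) = w (σ.b2 + k) := σ.copies_eq
  refine ⟨fun ⟨hp1, hp2, hp⟩ => ⟨hp1, by omega, fun k hk hkj => ?_⟩,
    fun ⟨hp1, hp2, hp⟩ => ⟨hp1, by omega, fun k hk hkj => ?_⟩⟩
  · obtain ⟨d, rfl⟩ := Nat.exists_eq_add_of_le hk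
    have := hp (σ.b1 + d) (by omega) (by omega)
    rwa [add_assoc, hshift d (by omega), hshift (d + p) (by omega), ← add_assoc] at this
  · obtain ⟨d, rfl⟩ := Nat.exists_eq_add_of_le hk
    have := hp (σ.b2 + d) (by omega) (by omega)
    rwa [add_assoc, ← hshift d (by omega), ← hshift (d + p) (by omega), ← add_assoc] at this

/-- The two copies of a repeat have the same minimal period. -/
theorem WordRepeat.minPer_eq {n : ℕ} {w : ℕ → A} (σ : WordRepeat n w) :
    minPer w σ.b2 σ.e2 = minPer w σ.b1 σ.e1 :=
  le_antisymm (minPer_le ((σ.isPeriodOf_iff _).1 (isPeriodOf_minPer w _ _)))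
    (minPer_le ((σ.isPeriodOf_iff _).2 (isPeriodOf_minPer w _ _)))

/-- Any reprincipal `α`-periodic repeat is birepresented: if `σ` is the principal repeat
of a maximal repetition and the minimal period of its copies is at most `p(σ)/(3α)`,
then `σ` is a periodic repeat represented by a pair of two distinct maximal repetitions,
and it is not represented by any single maximal repetition. -/
theorem reprincipal_alpha_periodic_is_birepresented {A : Type*} (α : ℝ) (hα : 1 ≤ α)
    (n : ℕ) (w : ℕ → A) (σ : WordRepeat n w)
    (hprin : IsPrincipalOfMaxRepetition σ)
    (hαper : (minPer w σ.b1 σ.e1 : ℝ) ≤ (σ.p : ℝ) / (3 * α)) :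
    IsPeriodicRepeat σ ∧ (∃ i1 j1 i2 j2, RepresentedByPair σ i1 j1 i2 j2) ∧
      ∀ i j, ¬ RepresentedBy σ i j := by
  obtain ⟨a, b, ⟨ha, hab, hbn, hrep, -⟩, hb1, he1, hb2, he2⟩ := hprin
  have hq1 := (isPeriodOf_minPer w σ.b1 σ.e1).1
  have hp : σ.p = minPer w a b := by
    unfold WordRepeat.p
    omega
  have hq3 : 3 * minPer w σ.b1 σ.e1 ≤ σ.p := by
    have h := (le_div_iff₀ (by positivity)).1 hαper
    have hmul := mul_le_mul_of_nonneg_left hα (Nat.cast_nonneg (α := ℝ) (minPer w σ.b1 σ.e1))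
    have : (3 : ℝ) * minPer w σ.b1 σ.e1 ≤ σ.p := by linarith
    exact_mod_cast this
  have hc : σ.p ≤ σ.c := by
    unfold WordRepeat.c
    omega
  have hper : IsPeriodicRepeat σ := hq3.trans hc
  have hnot : ∀ i j, i ≤ σ.b1 → σ.e2 ≤ j → minPer w i j ≠ minPer w σ.b1 σ.e1 := by
    intro i j hi hj heq
    have := minPer_le ((isPeriodOf_minPer w i j).subfactor (i := a) (j := b)
      (hb1 ▸ hi) (he2 ▸ hj) (by omega))
    omega
  have hlen : 2 * minPer w σ.b1 σ.e1 ≤ σ.e1 - σ.b1 + 1 := by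
    have : 3 * minPer w σ.b1 σ.e1 ≤ σ.e1 - σ.b1 + 1 := hper
    omega
  have h1 := σ.b1_le_e1
  have h2 := σ.b2_le_e2
  obtain ⟨i1, j1, hmax1, hmin1, hi1, hj1⟩ := exists_isMaxRepetition_extending (n := n)
    σ.one_le_b1 σ.b1_le_e1 (by omega) hlen
  obtain ⟨i2, j2, hmax2, hmin2, hi2, hj2⟩ := exists_isMaxRepetition_extending (n := n)
    (w := w) (by omega) σ.b2_le_e2 σ.e2_le_n (by rw [σ.minPer_eq, ← σ.len_eq]; exact hlen)
  refine ⟨hper, ⟨i1, j1, i2, j2, hper, hmax1, hmax2, hmin1, hmin2.trans σ.minPer_eq,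
    hi1, hj1, hi2, hj2, ?_⟩, fun i j ⟨_, _, hmin, hi, hj⟩ => hnot i j hi hj hmin⟩
  rintro ⟨rfl, rfl⟩
  exact hnot i1 j1 hi1 hj2 hmin1
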